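/- Fix an integer n ≥ 3. Every finite K_n-free graph X has a finite Ramsey degree in the class H_n of all finite K_n-free graphs, equal to |X|!/|Aut(X)|, where Aut(X) is the automorphism group of the graph X. That is: |X|!/|Aut(X)| is the least natural number t such that for every Y ∈ H_n and every k ∈ ℕ there exists Z ∈ H_n such that for every map α from the copies of X in Z to {1,…,k} there is a copy Ỹ of Y in Z such that α takes at most t values on the copies of X in Ỹ. -/

import Mathlib

/-- `f` is an embedding of ordered graphs (vertex sets `Fin a`, `Fin c` with their
natural linear orders): strictly increasing, preserving and reflecting adjacency. -/
def OrdEmb {a c : ℕ} (X : SimpleGraph (Fin a)) (Z : SimpleGraph (Fin c))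
    (f : Fin a → Fin c) : Prop :=
  StrictMono f ∧ ∀ i j, Z.Adj (f i) (f j) ↔ X.Adj i j

/-- `lam` is a proper coloring of `X` with colors in `Fin n`. -/
def ProperCol {a n : ℕ} (X : SimpleGraph (Fin a)) (lam : Fin a → Fin n) : Prop :=
  ∀ i j, X.Adj i j → lam i ≠ lam j

/-- `f` is an embedding of ordered `[n]`-colored graphs: an ordered-graph embedding
that also preserves the vertex colorings. -/
def ColOrdEmb {n a c : ℕ} (X : SimpleGraph (Fin a)) (lamX : Fin a → Fin n)
    (Z : SimpleGraph (Fin c)) (lamZ : Fin c → Fin n) (f : Fin a → Fin c) : Prop :=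
  OrdEmb X Z f ∧ ∀ i, lamZ (f i) = lamX i

/-- `S` is the vertex set of an induced copy of the (unordered) graph `X` in `Z`. -/
def IsCopy {a c : ℕ} (X : SimpleGraph (Fin a)) (Z : SimpleGraph (Fin c))
    (S : Finset (Fin c)) : Prop :=
  ∃ f : Fin a → Fin c, Function.Injective f ∧
    (∀ i j, Z.Adj (f i) (f j) ↔ X.Adj i j) ∧ Finset.image f Finset.univ = S

section PartiteStep

open Combinatorics Function

variable {W I V ι : Type} {A : SimpleGraph W} {G : SimpleGraph I} {P : SimpleGraph V}

/-- A graph is `K_n`-free iff no `n`-indexed family of vertices is pairwise adjacent. -/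
lemma cliqueFree_iff_forall_family {V : Type*} (G : SimpleGraph V) (n : ℕ) :
    G.CliqueFree n ↔ ∀ c : Fin n → V, ¬ ∀ i j, i ≠ j → G.Adj (c i) (c j) := by
  rw [SimpleGraph.cliqueFree_iff]
  constructor
  · intro h c hc
    refine h.elim ⟨⟨c, fun {i j} hij => hc i j hij⟩, fun i j hij => ?_⟩
    by_contra hne
    exact (hc i j hne).ne hij
  · intro h
    exact ⟨fun e => h e fun i j hij => e.toHom.map_rel hij⟩

/-- Copies of `A` in `P` whose vertex `i` lies in the part `m i`. -/
abbrev TransversalCopy (A : SimpleGraph W) (π : P →g G) (m : W → I) : Type :=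
  {e : A ↪g P // ∀ i, π (e i) = m i}

/-- The copy of `P` in the amalgam determined by a combinatorial line `l`: vertices in the parts
`m i` are sent into the power of `P`, the other ones to a private copy indexed by `l`. -/
noncomputable def lineMap (π : P →g G) (m : W → I) (l : Line (TransversalCopy A π m) ι) (v : V) :
    (W × (ι → V)) ⊕ (Line (TransversalCopy A π m) ι × V) :=
  match partialInv m (π v) with
  | some i => .inl (i, fun t => (l.idxFun t).elim v fun e => e.1 i)
  | none => .inr (l, v)

/-- Adjacency in the partite power of `P`: on pairs of parts joined in `A` it is coordinatewise
adjacency, on the other pairs it is adjacency in some coordinate. -/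
def PowerAdj (A : SimpleGraph W) (π : P →g G) (m : W → I) (x y : W × (ι → V)) : Prop :=
  (∀ t, π (x.2 t) = m x.1) ∧ (∀ t, π (y.2 t) = m y.1) ∧ (∃ t, P.Adj (x.2 t) (y.2 t)) ∧
    (A.Adj x.1 y.1 → ∀ t, P.Adj (x.2 t) (y.2 t))

lemma PowerAdj.symm {π : P →g G} {m : W → I} {x y : W × (ι → V)} (h : PowerAdj A π m x y) :
    PowerAdj A π m y x :=
  ⟨h.2.1, h.1, h.2.2.1.imp fun _ => SimpleGraph.Adj.symm,
    fun hA t => (h.2.2.2 hA.symm t).symm⟩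

section LineMap

variable {π : P →g G} {m : W → I} (l : Line (TransversalCopy A π m) ι)

lemma lineMap_of_eq (hm : Injective m) {v : V} {i : W} (h : π v = m i) :
    lineMap π m l v = .inl (i, fun t => (l.idxFun t).elim v fun e => e.1 i) := by
  simp [lineMap, h, partialInv_left hm]

lemma lineMap_of_forall_ne (hm : Injective m) {v : V} (h : ∀ i, π v ≠ m i) :
    lineMap π m l v = .inr (l, v) := by
  have : partialInv m (π v) = none := by
    rw [Option.eq_none_iff_forall_ne_some]
    intro i hi
    exact h i ((hm.isPartialInv _ _).1 hi).symm
  simp [lineMap, this]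

lemma exists_eq_of_lineMap_eq_inl (hm : Injective m) {v : V} {x : W × (ι → V)}
    (h : lineMap π m l v = .inl x) : π v = m x.1 := by
  by_cases hv : ∃ i, π v = m i
  · obtain ⟨i, hi⟩ := hv
    rw [lineMap_of_eq l hm hi, Sum.inl.injEq] at h
    rw [hi, ← h]
  · push Not at hv
    simp [lineMap_of_forall_ne l hm hv] at h

lemma eq_of_lineMap_eq_inr (hm : Injective m) {l' : Line (TransversalCopy A π m) ι} {v w : V}
    (h : lineMap π m l v = .inr (l', w)) : l = l' ∧ v = w := by
  by_cases hv : ∃ i, π v = m i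
  · obtain ⟨i, hi⟩ := hv
    simp [lineMap_of_eq l hm hi] at h
  · push Not at hv
    simpa [lineMap_of_forall_ne l hm hv] using h

lemma lineMap_injective (hm : Injective m) : Injective (lineMap π m l) := by
  intro v w h
  cases hw : lineMap π m l w with
  | inl x =>
    have hv := exists_eq_of_lineMap_eq_inl l hm (h.trans hw)
    have hw' := exists_eq_of_lineMap_eq_inl l hm hw
    rw [lineMap_of_eq l hm hv, lineMap_of_eq l hm hw'] at h
    obtain ⟨t, ht⟩ := l.proper
    simpa [ht] using congrFun (congrArg Prod.snd (Sum.inl.inj h)) t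
  | inr y =>
    exact (eq_of_lineMap_eq_inr l hm (h.trans hw)).2.trans (eq_of_lineMap_eq_inr l hm hw).2.symm

lemma powerAdj_iff_of_lineMap_eq (hm : Injective m) {v w : V} {x y : W × (ι → V)}
    (hx : lineMap π m l v = .inl x) (hy : lineMap π m l w = .inl y) :
    PowerAdj A π m x y ↔ P.Adj v w := by
  have hv := exists_eq_of_lineMap_eq_inl l hm hx
  have hw := exists_eq_of_lineMap_eq_inl l hm hy
  rw [lineMap_of_eq l hm hv, Sum.inl.injEq, Prod.ext_iff] at hx
  rw [lineMap_of_eq l hm hw, Sum.inl.injEq, Prod.ext_iff] at hy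
  obtain ⟨s, hs⟩ := l.proper
  have hxt : ∀ t, x.2 t = (l.idxFun t).elim v fun e => e.1 x.1 := fun t => by rw [← hx.2]
  have hyt : ∀ t, y.2 t = (l.idxFun t).elim w fun e => e.1 y.1 := fun t => by rw [← hy.2]
  have fixed : ∀ t e, l.idxFun t = some e → (P.Adj (x.2 t) (y.2 t) ↔ A.Adj x.1 y.1) := by
    intro t e ht
    rw [hxt, hyt, ht]
    exact e.1.map_rel_iff
  have moving : ∀ t, l.idxFun t = none → (P.Adj (x.2 t) (y.2 t) ↔ P.Adj v w) := by
    intro t ht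
    rw [hxt, hyt, ht]
    rfl
  constructor
  · rintro ⟨-, -, ⟨t, ht⟩, hall⟩
    cases hlt : l.idxFun t with
    | none => exact (moving t hlt).1 ht
    | some e => exact (moving s hs).1 (hall ((fixed t e hlt).1 ht) s)
  · intro hadj
    refine ⟨fun t => ?_, fun t => ?_, ⟨s, (moving s hs).2 hadj⟩, fun hA t => ?_⟩
    · rw [hxt]
      cases l.idxFun t with
      | none => exact hv
      | some e => exact e.2 _
    · rw [hyt]
      cases l.idxFun t with
      | none => exact hw
      | some e => exact e.2 _
    · cases hlt : l.idxFun t with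
      | none => exact (moving t hlt).2 hadj
      | some e => exact (fixed t e hlt).2 hA

end LineMap

/-- The free amalgam of copies of `P`, one for each combinatorial line, over the partite power. -/
noncomputable def amalgam (ι : Type) (A : SimpleGraph W) (π : P →g G) {m : W → I}
    (hm : Injective m) :
    SimpleGraph ((W × (ι → V)) ⊕ (Line (TransversalCopy A π m) ι × V)) where
  Adj p q := (∃ x y, p = .inl x ∧ q = .inl y ∧ PowerAdj A π m x y) ∨
    ∃ l v w, P.Adj v w ∧ p = lineMap π m l v ∧ q = lineMap π m l w
  symm := ⟨by
    rintro p q (⟨x, y, hx, hy, h⟩ | ⟨l, v, w, h, hv, hw⟩)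
    · exact .inl ⟨y, x, hy, hx, h.symm⟩
    · exact .inr ⟨l, w, v, h.symm, hw, hv⟩⟩
  loopless := ⟨by
    rintro p (⟨x, y, hx, hy, h⟩ | ⟨l, v, w, h, hv, hw⟩)
    · obtain rfl := Sum.inl.inj (hx.symm.trans hy)
      exact h.2.2.1.elim fun t ht => ht.ne rfl
    · exact h.ne (lineMap_injective l hm (hv.symm.trans hw))⟩

section Amalgam

variable {π : P →g G} {m : W → I} (hm : Injective m)

lemma amalgam_adj_inl {x y : W × (ι → V)} :
    (amalgam ι A π hm).Adj (.inl x) (.inl y) ↔ PowerAdj A π m x y := by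
  constructor
  · rintro (⟨x', y', hx, hy, h⟩ | ⟨l, v, w, h, hv, hw⟩)
    · rwa [Sum.inl.inj hx, Sum.inl.inj hy]
    · exact (powerAdj_iff_of_lineMap_eq l hm hv.symm hw.symm).2 h
  · exact fun h => .inl ⟨x, y, rfl, rfl, h⟩

lemma amalgam_adj_inr {l : Line (TransversalCopy A π m) ι} {v : V}
    {q : (W × (ι → V)) ⊕ (Line (TransversalCopy A π m) ι × V)}
    (h : (amalgam ι A π hm).Adj (.inr (l, v)) q) :
    lineMap π m l v = .inr (l, v) ∧ ∃ w, P.Adj v w ∧ q = lineMap π m l w := by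
  rcases h with ⟨x, y, hx, -, -⟩ | ⟨l', v', w, h, hv, hw⟩
  · cases hx
  · obtain ⟨rfl, rfl⟩ := eq_of_lineMap_eq_inr l' hm hv.symm
    exact ⟨hv.symm, w, h, hw⟩

/-- Every combinatorial line gives an induced copy of `P` in the amalgam. -/
noncomputable def lineEmbedding (l : Line (TransversalCopy A π m) ι) : P ↪g amalgam ι A π hm where
  toFun := lineMap π m l
  inj' := lineMap_injective l hm
  map_rel_iff' {v w} := by
    change (amalgam ι A π hm).Adj (lineMap π m l v) (lineMap π m l w) ↔ P.Adj v w
    refine ⟨fun h => ?_, fun h => .inr ⟨l, v, w, h, rfl, rfl⟩⟩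
    cases hv : lineMap π m l v with
    | inr y =>
      obtain ⟨rfl, rfl⟩ := eq_of_lineMap_eq_inr (l' := y.1) (w := y.2) l hm hv
      rw [hv] at h
      obtain ⟨-, w', hw', hw⟩ := amalgam_adj_inr hm h
      rwa [lineMap_injective _ hm hw]
    | inl x =>
      cases hw : lineMap π m l w with
      | inr y =>
        obtain ⟨rfl, rfl⟩ := eq_of_lineMap_eq_inr (l' := y.1) (w := y.2) l hm hw
        rw [hw] at h
        obtain ⟨-, v', hv', hv⟩ := amalgam_adj_inr hm h.symm
        rw [lineMap_injective _ hm hv]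
        exact hv'.symm
      | inl y =>
        rw [hv, hw, amalgam_adj_inl] at h
        exact (powerAdj_iff_of_lineMap_eq l hm hv hw).1 h

/-- The projection of the amalgam to the index graph. -/
noncomputable def amalgamProj (ι : Type) (A : SimpleGraph W) (π : P →g G) {m : W → I}
    (hm : Injective m) : amalgam ι A π hm →g G where
  toFun := Sum.elim (fun x => m x.1) fun y => π y.2
  map_rel' {p q} h := by
    have key : ∀ (l : Line (TransversalCopy A π m) ι) v,
        Sum.elim (fun x => m x.1) (fun y => π y.2) (lineMap π m l v) = π v := by
      intro l v
      cases hv : lineMap π m l v with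
      | inl x => exact (exists_eq_of_lineMap_eq_inl l hm hv).symm
      | inr y => rw [(eq_of_lineMap_eq_inr (l' := y.1) (w := y.2) l hm hv).2]; rfl
    rcases h with ⟨x, y, rfl, rfl, hx, hy, ⟨t, ht⟩, -⟩ | ⟨l, v, w, h, rfl, rfl⟩
    · have := π.map_rel ht
      rwa [hx, hy] at this
    · rw [key, key]
      exact π.map_rel h

lemma amalgamProj_lineEmbedding (l : Line (TransversalCopy A π m) ι) (v : V) :
    amalgamProj ι A π hm (lineEmbedding hm l v) = π v := by
  change Sum.elim (fun x => m x.1) (fun y => π y.2) (lineMap π m l v) = π v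
  cases hv : lineMap π m l v with
  | inl x => exact (exists_eq_of_lineMap_eq_inl l hm hv).symm
  | inr y => rw [(eq_of_lineMap_eq_inr (l' := y.1) (w := y.2) l hm hv).2]; rfl

lemma amalgam_cliqueFree {n : ℕ} (hA : A.CliqueFree n) (hP : P.CliqueFree n)
    (hmA : ∀ i j, G.Adj (m i) (m j) → A.Adj i j) : (amalgam ι A π hm).CliqueFree n := by
  rw [cliqueFree_iff_forall_family] at hA hP ⊢
  intro c hc
  by_cases hout : ∃ k l v, c k = .inr (l, v)
  · obtain ⟨k, l, v, hk⟩ := hout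
    by_cases hn : ∃ j, j ≠ k
    · have hv : lineMap π m l v = .inr (l, v) := by
        obtain ⟨j, hj⟩ := hn
        exact (amalgam_adj_inr hm (hk ▸ hc k j hj.symm)).1
      have hall : ∀ j, ∃ w, c j = lineEmbedding hm l w := by
        intro j
        by_cases hj : j = k
        · exact ⟨v, by rw [hj, hk]; exact hv.symm⟩
        · obtain ⟨-, w, -, hw⟩ := amalgam_adj_inr hm (hk ▸ hc k j (Ne.symm hj))
          exact ⟨w, hw⟩
      choose w hw using hall
      refine hP w fun i j hij => ?_
      have := hc i j hij
      rw [hw, hw] at this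
      exact (lineEmbedding hm l).map_rel_iff.1 this
    · push Not at hn
      exact hP (fun _ => v) fun i j hij => absurd ((hn i).trans (hn j).symm) hij
  · have hall : ∀ k, ∃ x, c k = .inl x := by
      intro k
      cases hk : c k with
      | inl x => exact ⟨x, rfl⟩
      | inr y => exact (hout ⟨k, y.1, y.2, hk⟩).elim
    choose x hx using hall
    refine hA (fun k => (x k).1) fun i j hij => hmA _ _ ?_
    have := (amalgamProj ι A π hm).map_rel (hc i j hij)
    rwa [hx, hx] at this

end Amalgam

/-- One step of the partite construction. -/
theorem exists_partite_step (n : ℕ) (κ : Type) [Finite κ] [Finite W] [Finite V] (π : P →g G)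
    {m : W → I} (hm : Injective m) :
    ∃ (V' : Type) (_ : Finite V') (P' : SimpleGraph V') (π' : P' →g G),
      (∀ χ : (W → V') → κ, ∃ φ : P ↪g P', (∀ v, π' (φ v) = π v) ∧
        ∀ e e' : A ↪g P, (∀ i, π (e i) = m i) → (∀ i, π (e' i) = m i) →
          χ (φ ∘ e) = χ (φ ∘ e')) ∧
      (A.CliqueFree n → P.CliqueFree n → (∀ i j, G.Adj (m i) (m j) → A.Adj i j) →
        P'.CliqueFree n) := by
  have : Finite (A ↪g P) :=
    Finite.of_injective (fun e : A ↪g P => (e : W → V)) DFunLike.coe_injective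
  obtain ⟨ι, _, hι⟩ := Line.exists_mono_in_high_dimension (TransversalCopy A π m) κ
  have : Finite (Line (TransversalCopy A π m) ι) :=
    Finite.of_injective Line.idxFun fun _ _ => Line.ext
  refine ⟨_, inferInstance, amalgam ι A π hm, amalgamProj ι A π hm, fun χ => ?_,
    amalgam_cliqueFree hm⟩
  obtain ⟨l, c, hl⟩ := hι fun u => χ fun i => .inl (i, fun t => (u t).1 i)
  refine ⟨lineEmbedding hm l, amalgamProj_lineEmbedding hm l, ?_⟩
  have key : ∀ e : A ↪g P, (∀ i, π (e i) = m i) → χ (lineEmbedding hm l ∘ e) = c := by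
    intro e he
    rw [← hl ⟨e, he⟩]
    congr 1
    funext i
    refine (lineMap_of_eq l hm (he i)).trans ?_
    congr 2
    funext t
    rw [Line.coe_apply]
    cases l.idxFun t <;> rfl
  intro e e' he he'
  rw [key e he, key e' he']

/-- Iterating the partite construction over a list of patterns. -/
theorem exists_partite_iterate (n : ℕ) (κ : Type) [Finite κ] [Finite W] [Finite V] (π : P →g G)
    (M : List (W → I)) (hM : ∀ m ∈ M, Injective m) :
    ∃ (V' : Type) (_ : Finite V') (P' : SimpleGraph V') (π' : P' →g G),
      (∀ χ : (W → V') → κ, ∃ φ : P ↪g P', (∀ v, π' (φ v) = π v) ∧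
        ∀ m ∈ M, ∀ e e' : A ↪g P, (∀ i, π (e i) = m i) → (∀ i, π (e' i) = m i) →
          χ (φ ∘ e) = χ (φ ∘ e')) ∧
      (A.CliqueFree n → P.CliqueFree n → (∀ m ∈ M, ∀ i j, G.Adj (m i) (m j) → A.Adj i j) →
        P'.CliqueFree n) := by
  induction M with
  | nil =>
    exact ⟨V, inferInstance, P, π, fun χ => ⟨.refl, fun _ => rfl, by simp⟩, fun _ h _ => h⟩
  | cons m M ih =>
    obtain ⟨V₁, _, P₁, π₁, h₁, hfree₁⟩ := ih fun m' hm' => hM m' (List.mem_cons_of_mem _ hm')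
    obtain ⟨V₂, _, P₂, π₂, h₂, hfree₂⟩ :=
      exists_partite_step (A := A) n κ π₁ (hM m List.mem_cons_self)
    refine ⟨V₂, inferInstance, P₂, π₂, fun χ => ?_, fun hA hP hMA => ?_⟩
    · obtain ⟨φ₂, hπ₂, hφ₂⟩ := h₂ χ
      obtain ⟨φ₁, hπ₁, hφ₁⟩ := h₁ fun f => χ (φ₂ ∘ f)
      refine ⟨φ₂.comp φ₁, fun v => (hπ₂ _).trans (hπ₁ v), fun m' hm' e e' he he' => ?_⟩
      rcases List.mem_cons.1 hm' with rfl | hm'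
      · exact hφ₂ (φ₁.comp e) (φ₁.comp e') (fun i => (hπ₁ _).trans (he i))
          fun i => (hπ₁ _).trans (he' i)
      · exact hφ₁ m' hm' e e' he he'
    · exact hfree₂ hA (hfree₁ hA hP fun m' hm' => hMA m' (List.mem_cons_of_mem _ hm'))
        (hMA m List.mem_cons_self)

end PartiteStep

section FiniteRamsey

open Filter

lemma Ultrafilter.exists_eventually_eq {ι κ : Type*} [Finite κ] (U : Ultrafilter ι) (f : ι → κ) :
    ∃ c, ∀ᶠ y in U, f y = c := by
  obtain ⟨c, hc⟩ := (U.map f).eq_pure_of_finite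
  refine ⟨c, ?_⟩
  have : {c} ∈ U.map f := by rw [hc]; exact mem_pure.2 rfl
  exact Ultrafilter.mem_map.1 this

/-- The colour of `s` in the limit of adding one more point. -/
noncomputable def limitColoring {κ : Type*} [Finite κ] (χ : Finset ℕ → κ) (s : Finset ℕ) : κ :=
  ((hyperfilter ℕ).exists_eventually_eq fun y => χ (insert y s)).choose

lemma eventually_eq_limitColoring {κ : Type*} [Finite κ] (χ : Finset ℕ → κ) (s : Finset ℕ) :
    ∀ᶠ y in hyperfilter ℕ, χ (insert y s) = limitColoring χ s :=
  ((hyperfilter ℕ).exists_eventually_eq fun y => χ (insert y s)).choose_spec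

lemma eventually_hyperfilter_gt (N : ℕ) : ∀ᶠ y in hyperfilter ℕ, N < y := by
  have := hyperfilter_le_cofinite (α := ℕ)
  rw [Nat.cofinite_eq_atTop] at this
  exact this (eventually_gt_atTop N)

/-- Every colouring of the `a`-subsets of `ℕ` has homogeneous sets of every finite size. -/
lemma exists_homogeneous {κ : Type*} [Finite κ] (a b : ℕ) (χ : Finset ℕ → κ) :
    ∃ c, ∃ X : Finset ℕ, X.card = b ∧ ∀ S ⊆ X, S.card = a → χ S = c := by
  refine ⟨limitColoring^[a] χ ∅, ?_⟩
  suffices h : ∃ X : Finset ℕ, X.card = b ∧ ∀ S ⊆ X, ∀ j, S.card + j = a →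
      limitColoring^[j] χ S = limitColoring^[a] χ ∅ by
    obtain ⟨X, hX, h⟩ := h
    exact ⟨X, hX, fun S hS hSa => h S hS 0 (by simpa using hSa)⟩
  induction b with
  | zero =>
    refine ⟨∅, rfl, fun S hS j hj => ?_⟩
    obtain rfl := Finset.subset_empty.1 hS
    rw [← hj]
    simp
  | succ b ih =>
    obtain ⟨X, hX, h⟩ := ih
    have hev : ∀ᶠ y in hyperfilter ℕ, ∀ S ∈ X.powerset, ∀ j ∈ Finset.range (a + 1),
        limitColoring^[j] χ (insert y S) = limitColoring^[j + 1] χ S := by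
      rw [Finset.eventually_all]
      intro S _
      rw [Finset.eventually_all]
      intro j _
      rw [Function.iterate_succ_apply']
      exact eventually_eq_limitColoring _ S
    obtain ⟨y, hy, hyX⟩ := (hev.and (eventually_hyperfilter_gt (X.sup id))).exists
    have hyX' : y ∉ X := fun hmem => absurd (Finset.le_sup (f := id) hmem) (not_le.2 hyX)
    refine ⟨insert y X, by rw [Finset.card_insert_of_notMem hyX', hX], fun S hS j hj => ?_⟩
    by_cases hyS : y ∈ S
    · have hsub : S.erase y ⊆ X := by
        intro z hz
        obtain ⟨hne, hz⟩ := Finset.mem_erase.1 hz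
        exact (Finset.mem_insert.1 (hS hz)).resolve_left hne
      have hcard := Finset.card_erase_add_one hyS
      rw [← Finset.insert_erase hyS,
        hy _ (Finset.mem_powerset.2 hsub) j (Finset.mem_range.2 (by omega))]
      exact h _ hsub _ (by omega)
    · exact h S ((Finset.subset_insert_iff_of_notMem hyS).1 hS) j hj

/-- The finite Ramsey theorem for `a`-subsets. -/
theorem exists_finite_ramsey (κ : Type*) [Finite κ] (a b : ℕ) :
    ∃ p, ∀ χ : Finset ℕ → κ, ∃ X ⊆ Finset.range p, X.card = b ∧
      ∃ c, ∀ S ⊆ X, S.card = a → χ S = c := by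
  by_contra! hbad
  choose χ hχ using hbad
  choose lim hlim using fun S => (hyperfilter ℕ).exists_eventually_eq fun p => χ p S
  obtain ⟨c, X, hX, h⟩ := exists_homogeneous a b lim
  have hev : ∀ᶠ p in hyperfilter ℕ, ∀ S ∈ X.powerset, χ p S = lim S := by
    rw [Finset.eventually_all]
    exact fun S _ => hlim S
  obtain ⟨p, hp, hpX⟩ := (hev.and (eventually_hyperfilter_gt (X.sup id))).exists
  obtain ⟨S, hS, hSa, hne⟩ := hχ p X
    (fun x hx => Finset.mem_range.2 ((Finset.le_sup (f := id) hx).trans_lt hpX)) hX c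
  exact hne ((hp S (Finset.mem_powerset.2 hS)).trans (h S hS hSa))

lemma StrictMono.eq_of_image_univ_eq {a : ℕ} {β : Type*} [LinearOrder β] {f g : Fin a → β}
    (hf : StrictMono f) (hg : StrictMono g)
    (h : Finset.univ.image f = Finset.univ.image g) : f = g := by
  have hcard : (Finset.univ.image g).card = a := by
    rw [Finset.card_image_of_injective _ hg.injective, Finset.card_fin]
  exact (Finset.orderEmbOfFin_unique hcard
      (fun x => h ▸ Finset.mem_image_of_mem _ (Finset.mem_univ x)) hf).trans
    (Finset.orderEmbOfFin_unique hcard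
      (fun x => Finset.mem_image_of_mem _ (Finset.mem_univ x)) hg).symm

/-- The finite Ramsey theorem for strictly increasing maps. -/
theorem exists_strictMono_ramsey (κ : Type*) [Finite κ] [Nonempty κ] (a b : ℕ) :
    ∃ p, ∀ χ : (Fin a → Fin p) → κ, ∃ β : Fin b → Fin p, StrictMono β ∧
      ∃ c, ∀ f : Fin a → Fin b, StrictMono f → χ (β ∘ f) = c := by
  classical
  obtain ⟨p, hp⟩ := exists_finite_ramsey κ a b
  refine ⟨p, fun χ => ?_⟩
  let lift (f : Fin a → Fin p) : Finset ℕ := Finset.univ.image fun i => (f i : ℕ)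
  obtain ⟨X, hXp, hX, c, hc⟩ := hp fun S =>
    if h : ∃ f : Fin a → Fin p, StrictMono f ∧ lift f = S then χ h.choose
    else Classical.arbitrary κ
  let β : Fin b → Fin p := fun i =>
    ⟨X.orderEmbOfFin hX i, Finset.mem_range.1 (hXp (X.orderEmbOfFin_mem hX i))⟩
  have hβ : StrictMono β := fun i j hij => (X.orderEmbOfFin hX).strictMono hij
  refine ⟨β, hβ, c, fun f hf => ?_⟩
  have hinj : StrictMono fun i => ((β ∘ f) i : ℕ) := fun i j hij => hβ (hf hij)
  have hex : ∃ f' : Fin a → Fin p, StrictMono f' ∧ lift f' = lift (β ∘ f) :=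
    ⟨β ∘ f, hβ.comp hf, rfl⟩
  have hS := hc (lift (β ∘ f))
    (Finset.image_subset_iff.2 fun i _ => X.orderEmbOfFin_mem hX (f i))
    (by rw [Finset.card_image_of_injective _ hinj.injective, Finset.card_fin])
  rw [dif_pos hex] at hS
  have heq : (fun i => (hex.choose i : ℕ)) = fun i => ((β ∘ f) i : ℕ) :=
    StrictMono.eq_of_image_univ_eq (fun i j hij => hex.choose_spec.1 hij) hinj hex.choose_spec.2
  rw [← hS]
  congr 1
  funext i
  exact Fin.ext (congrFun heq i).symm

end FiniteRamsey

section OrderedRamsey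

variable {a b c : ℕ}

/-- For every colouring of the maps from the vertices of `A` to those of `C` there is an ordered
copy of `B` in `C` all of whose ordered copies of `A` have the same colour. -/
def OrdArrow (κ : Type) (A : SimpleGraph (Fin a)) (B : SimpleGraph (Fin b))
    (C : SimpleGraph (Fin c)) : Prop :=
  ∀ χ : (Fin a → Fin c) → κ, ∃ g : Fin b → Fin c, OrdEmb B C g ∧
    ∀ f f' : Fin a → Fin b, OrdEmb A B f → OrdEmb A B f' → χ (g ∘ f) = χ (g ∘ f')

lemma OrdEmb.comp {A : SimpleGraph (Fin a)} {B : SimpleGraph (Fin b)} {C : SimpleGraph (Fin c)}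
    {g : Fin b → Fin c} {f : Fin a → Fin b} (hg : OrdEmb B C g) (hf : OrdEmb A B f) :
    OrdEmb A C (g ∘ f) :=
  ⟨hg.1.comp hf.1, fun i j => (hg.2 _ _).trans (hf.2 i j)⟩

/-- The disjoint union of copies of `B` indexed by a set of maps. -/
def copiesGraph {p : ℕ} (good : Set (Fin b → Fin p)) (B : SimpleGraph (Fin b)) :
    SimpleGraph (good × Fin b) where
  Adj x y := x.1 = y.1 ∧ B.Adj x.2 y.2
  symm := ⟨fun _ _ h => ⟨h.1.symm, h.2.symm⟩⟩
  loopless := ⟨fun _ h => h.2.ne rfl⟩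

lemma cliqueFree_of_hom {V W : Type*} {G : SimpleGraph V} {H : SimpleGraph W} {n : ℕ}
    (f : G →g H) (h : H.CliqueFree n) : G.CliqueFree n := by
  rw [cliqueFree_iff_forall_family] at h ⊢
  exact fun c hc => h (f ∘ c) fun i j hij => f.map_rel (hc i j hij)

/-- A finite type with a map to `Fin p` can be enumerated so that the map is monotone. -/
lemma exists_equiv_fin_of_proj {V : Type} [Finite V] {p : ℕ} (π : V → Fin p) :
    ∃ (c : ℕ) (e : V ≃ Fin c), ∀ v w, π v < π w → e v < e w := by
  classical
  have := Fintype.ofFinite V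
  let key : V → Fin p ×ₗ Fin (Fintype.card V) := fun v => toLex (π v, Fintype.equivFin V v)
  have hkey : Function.Injective key := fun v w h =>
    (Fintype.equivFin V).injective (congrArg Prod.snd (toLex.injective h))
  let _ : LinearOrder V := LinearOrder.lift' key hkey
  let e := (Fintype.orderIsoFinOfCardEq V rfl).symm
  refine ⟨_, e.toEquiv, fun v w h => e.strictMono ?_⟩
  change key v < key w
  exact Prod.Lex.toLex_lt_toLex.2 (.inl h)

/-- The partite construction over a base graph `G` having the Ramsey property for a prescribed set
of maps `B → G`. -/
theorem exists_ordArrow_of_base {p : ℕ} (n : ℕ) (κ : Type) [Finite κ] [Nonempty κ]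
    (A : SimpleGraph (Fin a)) (B : SimpleGraph (Fin b)) (G : SimpleGraph (Fin p))
    (good : Set (Fin b → Fin p)) (hmono : ∀ β ∈ good, StrictMono β)
    (hhom : ∀ β ∈ good, ∀ x y, B.Adj x y → G.Adj (β x) (β y))
    (hR : ∀ χ : (Fin a → Fin p) → κ, ∃ β ∈ good,
      ∀ f f' : Fin a → Fin b, OrdEmb A B f → OrdEmb A B f' → χ (β ∘ f) = χ (β ∘ f')) :
    ∃ (c : ℕ) (C : SimpleGraph (Fin c)), OrdArrow κ A B C ∧
      (A.CliqueFree n → B.CliqueFree n →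
        (∀ β ∈ good, ∀ x y, G.Adj (β x) (β y) → B.Adj x y) → C.CliqueFree n) := by
  classical
  let π₀ : copiesGraph good B →g G := ⟨fun x => x.1.1 x.2, by
    rintro ⟨β, x⟩ ⟨β', y⟩ ⟨h, hadj⟩
    obtain rfl : β = β' := h
    exact hhom β.1 β.2 x y hadj⟩
  let patterns : Set (Fin a → Fin p) := {m | ∃ β ∈ good, ∃ f, OrdEmb A B f ∧ m = β ∘ f}
  have hmem : ∀ m, m ∈ patterns.toFinset.toList ↔ m ∈ patterns := by simp
  obtain ⟨V, _, P, π, hP, hfree⟩ := exists_partite_iterate (A := A) n κ π₀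
    patterns.toFinset.toList (by
      intro m hm
      obtain ⟨β, hβ, f, hf, rfl⟩ := (hmem m).1 hm
      exact ((hmono β hβ).comp hf.1).injective)
  obtain ⟨c, e, he⟩ := exists_equiv_fin_of_proj π
  refine ⟨c, P.comap e.symm, fun χ => ?_, fun hA hB hG => ?_⟩
  · obtain ⟨φ, hφπ, hφ⟩ := hP fun f => χ (e ∘ f)
    let copy (β : good) (f : Fin a → Fin b) (hf : OrdEmb A B f) : A ↪g copiesGraph good B :=
      { toFun := fun i => (β, f i)
        inj' := fun i j h => hf.1.injective (congrArg Prod.snd h)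
        map_rel_iff' := fun {i j} => (and_iff_right rfl).trans (hf.2 i j) }
    obtain ⟨β, hβ, hmonochrom⟩ := hR fun m =>
      if h : ∃ u : A ↪g copiesGraph good B, ∀ i, π₀ (u i) = m i
        then χ (e ∘ φ ∘ h.choose) else Classical.arbitrary κ
    refine ⟨fun x => e (φ (⟨β, hβ⟩, x)), ⟨fun x y hxy => he _ _ ?_, fun x y => ?_⟩, ?_⟩
    · rw [hφπ, hφπ]
      exact hmono β hβ hxy
    · change P.Adj (e.symm (e _)) (e.symm (e _)) ↔ _
      rw [e.symm_apply_apply, e.symm_apply_apply]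
      exact φ.map_rel_iff.trans (and_iff_right rfl)
    · have key : ∀ (f : Fin a → Fin b) (hf : OrdEmb A B f),
          χ ((fun x => e (φ (⟨β, hβ⟩, x))) ∘ f) =
            (if h : ∃ u : A ↪g copiesGraph good B, ∀ i, π₀ (u i) = (β ∘ f) i
              then χ (e ∘ φ ∘ h.choose) else Classical.arbitrary κ) := by
        intro f hf
        have hex : ∃ u : A ↪g copiesGraph good B, ∀ i, π₀ (u i) = (β ∘ f) i :=
          ⟨copy ⟨β, hβ⟩ f hf, fun _ => rfl⟩
        rw [dif_pos hex]
        exact hφ (β ∘ f) ((hmem _).2 ⟨β, hβ, f, hf, rfl⟩) (copy ⟨β, hβ⟩ f hf) hex.choose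
          (fun _ => rfl) hex.choose_spec
      intro f f' hf hf'
      rw [key f hf, key f' hf']
      exact hmonochrom f f' hf hf'
  · refine cliqueFree_of_hom (⟨e.symm, fun h => h⟩ : P.comap e.symm →g P) (hfree hA ?_ ?_)
    · exact cliqueFree_of_hom (⟨Prod.snd, fun h => h.2⟩ : copiesGraph good B →g B) hB
    · intro m hm i j hadj
      obtain ⟨β, hβ, f, hf, rfl⟩ := (hmem m).1 hm
      exact (hf.2 i j).1 (hG β hβ _ _ hadj)

/-- The Nešetřil–Rödl theorem for ordered `K_n`-free graphs. -/
theorem exists_cliqueFree_ordArrow (n : ℕ) (κ : Type) [Finite κ] [Nonempty κ]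
    (A : SimpleGraph (Fin a)) (B : SimpleGraph (Fin b)) (hA : A.CliqueFree n)
    (hB : B.CliqueFree n) :
    ∃ (c : ℕ) (C : SimpleGraph (Fin c)), OrdArrow κ A B C ∧ C.CliqueFree n := by
  obtain ⟨p, hp⟩ := exists_strictMono_ramsey κ a b
  obtain ⟨q, G, hG, -⟩ := exists_ordArrow_of_base n κ A B (⊤ : SimpleGraph (Fin p))
    {β | StrictMono β} (fun _ h => h) (fun β hβ x y hxy h => hxy.ne (hβ.injective h)) fun χ => by
      obtain ⟨β, hβ, r, hr⟩ := hp χ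
      exact ⟨β, hβ, fun f f' hf hf' => (hr f hf.1).trans (hr f' hf'.1).symm⟩
  obtain ⟨c, C, hC, hfree⟩ := exists_ordArrow_of_base n κ A B G {β | OrdEmb B G β}
    (fun _ h => h.1) (fun β hβ x y => (hβ.2 x y).2) hG
  exact ⟨c, C, hC, hfree hA hB fun β hβ x y => (hβ.2 x y).1⟩

/-- The Nešetřil–Rödl theorem, for a list of ordered graphs simultaneously. -/
theorem exists_cliqueFree_ordArrow_list (n : ℕ) (κ : Type) [Finite κ] [Nonempty κ]
    (B : SimpleGraph (Fin b)) (hB : B.CliqueFree n) (l : List (SimpleGraph (Fin a)))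
    (hl : ∀ A ∈ l, A.CliqueFree n) :
    ∃ (c : ℕ) (C : SimpleGraph (Fin c)), C.CliqueFree n ∧
      ∀ χ : (Fin a → Fin c) → κ, ∃ g : Fin b → Fin c, OrdEmb B C g ∧ ∀ A ∈ l,
        ∀ f f' : Fin a → Fin b, OrdEmb A B f → OrdEmb A B f' → χ (g ∘ f) = χ (g ∘ f') := by
  induction l with
  | nil => exact ⟨b, B, hB, fun χ => ⟨id, ⟨strictMono_id, fun _ _ => Iff.rfl⟩, by simp⟩⟩
  | cons A l ih =>
    obtain ⟨c₁, C₁, hfree₁, h₁⟩ := ih fun A' hA' => hl A' (List.mem_cons_of_mem _ hA')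
    obtain ⟨c₂, C₂, h₂, hfree₂⟩ :=
      exists_cliqueFree_ordArrow n κ A C₁ (hl A List.mem_cons_self) hfree₁
    refine ⟨c₂, C₂, hfree₂, fun χ => ?_⟩
    obtain ⟨g₂, hg₂, hχ₂⟩ := h₂ χ
    obtain ⟨g₁, hg₁, hχ₁⟩ := h₁ fun f => χ (g₂ ∘ f)
    refine ⟨g₂ ∘ g₁, hg₂.comp hg₁, fun A' hA' f f' hf hf' => ?_⟩
    rcases List.mem_cons.1 hA' with rfl | hA'
    · exact hχ₂ _ _ (hg₁.comp hf) (hg₁.comp hf')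
    · exact hχ₁ A' hA' f f' hf hf'

end OrderedRamsey

section OrderTypes

variable {a b c : ℕ}

/-- The graphs on `Fin a` isomorphic to `X`, i.e. the order types of `X`. -/
def orderTypes (X : SimpleGraph (Fin a)) : Set (SimpleGraph (Fin a)) := {A | Nonempty (A ≃g X)}

lemma self_mem_orderTypes (X : SimpleGraph (Fin a)) : X ∈ orderTypes X := ⟨.refl⟩

lemma cliqueFree_of_mem_orderTypes {n : ℕ} {X A : SimpleGraph (Fin a)} (hA : A ∈ orderTypes X)
    (hX : X.CliqueFree n) : A.CliqueFree n :=
  cliqueFree_of_hom hA.some.toHom hX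

lemma comap_rev_mem_orderTypes {X A : SimpleGraph (Fin a)} (hA : A ∈ orderTypes X) :
    A.comap Fin.rev ∈ orderTypes X :=
  ⟨(⟨Fin.revPerm, Iff.rfl⟩ : A.comap Fin.rev ≃g A).trans hA.some⟩

lemma card_orderTypes_mul (X : SimpleGraph (Fin a)) :
    Nat.card (orderTypes X) * Nat.card (X ≃g X) = a.factorial := by
  let iso : ∀ A : orderTypes X, A.1 ≃g X := fun A => A.2.some
  let F : orderTypes X × (X ≃g X) → Equiv.Perm (Fin a) := fun x =>
    ((iso x.1).trans x.2).toEquiv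
  have hcomap : ∀ x i j, X.Adj (F x i) (F x j) ↔ x.1.1.Adj i j := fun x i j =>
    ((iso x.1).trans x.2).map_rel_iff
  have hF : Function.Bijective F := by
    constructor
    · rintro ⟨A, θ⟩ ⟨A', θ'⟩ h
      obtain rfl : A = A' := by
        ext i j
        rw [← hcomap (A, θ), ← hcomap (A', θ'), h]
      refine Prod.ext rfl (RelIso.ext fun v => ?_)
      have := Equiv.congr_fun h ((iso A).symm v)
      simpa [F] using this
    · intro σ
      let A : orderTypes X := ⟨X.comap σ, ⟨⟨σ, Iff.rfl⟩⟩⟩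
      refine ⟨(A, (iso A).symm.trans ⟨σ, Iff.rfl⟩), Equiv.ext fun v => ?_⟩
      change σ ((iso A).symm (iso A v)) = σ v
      rw [RelIso.symm_apply_apply]
  rw [← Nat.card_prod, Nat.card_eq_of_bijective F hF, Nat.card_perm, Nat.card_fin]

lemma factorial_div_card_aut (X : SimpleGraph (Fin a)) :
    a.factorial / Nat.card (X ≃g X) = Nat.card (orderTypes X) := by
  have : Nonempty (X ≃g X) := ⟨.refl⟩
  have : Finite (X ≃g X) :=
    Finite.of_injective (fun e : X ≃g X => (e : Fin a → Fin a)) DFunLike.coe_injective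
  rw [← card_orderTypes_mul X, Nat.mul_div_cancel _ Nat.card_pos]

/-- Two enumerations of a copy of `X` differ by an isomorphism. -/
lemma comap_mem_orderTypes {X : SimpleGraph (Fin a)} {Z : SimpleGraph (Fin c)}
    {h : Fin a → Fin c} (hh : Function.Injective h) (hcopy : IsCopy X Z (Finset.univ.image h)) :
    Z.comap h ∈ orderTypes X := by
  obtain ⟨f, hf, hadj, himage⟩ := hcopy
  have hex : ∀ i, ∃ j, f j = h i := fun i => by
    have : h i ∈ Finset.univ.image f := himage ▸ Finset.mem_image_of_mem _ (Finset.mem_univ i)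
    simpa using this
  choose σ hσ using hex
  have hinj : Function.Injective σ := fun i j hij => hh (by rw [← hσ, ← hσ, hij])
  refine ⟨⟨Equiv.ofBijective σ (Finite.injective_iff_bijective.1 hinj), fun {i j} => ?_⟩⟩
  change X.Adj (σ i) (σ j) ↔ Z.Adj (h i) (h j)
  rw [← hadj, hσ, hσ]

end OrderTypes

section OrderingProperty

variable {a b c : ℕ}

/-- Two ordered `K_n`-free graphs embed into a common one. -/
lemma exists_joint_ordEmb {n : ℕ} (hn : 2 ≤ n) (A : SimpleGraph (Fin a)) (B : SimpleGraph (Fin b))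
    (hA : A.CliqueFree n) (hB : B.CliqueFree n) :
    ∃ (c : ℕ) (C : SimpleGraph (Fin c)), C.CliqueFree n ∧
      (∃ f, OrdEmb A C f) ∧ ∃ g, OrdEmb B C g := by
  refine ⟨a + b, (A ⊕g B).comap finSumFinEquiv.symm, ?_, ⟨Fin.castAdd b, ?_, ?_⟩,
    ⟨Fin.natAdd a, ?_, ?_⟩⟩
  · refine cliqueFree_of_hom
      (⟨finSumFinEquiv.symm, fun h => h⟩ : (A ⊕g B).comap finSumFinEquiv.symm →g A ⊕g B) ?_
    rw [cliqueFree_iff_forall_family] at hA hB ⊢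
    intro d hd
    let k : Fin n := ⟨0, by omega⟩
    cases hk : d k with
    | inl x =>
      have hall : ∀ i, ∃ y, d i = .inl y := by
        intro i
        by_cases hi : k = i
        · exact ⟨x, hi ▸ hk⟩
        · have := hd k i hi
          cases h : d i with
          | inl y => exact ⟨y, rfl⟩
          | inr y => simp [hk, h] at this
      choose y hy using hall
      exact hA y fun i j hij => by simpa [hy] using hd i j hij
    | inr x =>
      have hall : ∀ i, ∃ y, d i = .inr y := by
        intro i
        by_cases hi : k = i
        · exact ⟨x, hi ▸ hk⟩
        · have := hd k i hi
          cases h : d i with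
          | inr y => exact ⟨y, rfl⟩
          | inl y => simp [hk, h] at this
      choose y hy using hall
      exact hB y fun i j hij => by simpa [hy] using hd i j hij
  · exact Fin.strictMono_castAdd b
  · intro i j
    simp
  · exact Fin.strictMono_natAdd a
  · intro i j
    simp

/-- Finitely many ordered `K_n`-free graphs embed into a common one. -/
lemma exists_joint_ordEmb_list {n : ℕ} (hn : 2 ≤ n) (B : SimpleGraph (Fin b))
    (hB : B.CliqueFree n) (l : List (SimpleGraph (Fin a))) (hl : ∀ A ∈ l, A.CliqueFree n) :
    ∃ (c : ℕ) (C : SimpleGraph (Fin c)), C.CliqueFree n ∧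
      (∃ f, OrdEmb B C f) ∧ ∀ A ∈ l, ∃ g, OrdEmb A C g := by
  induction l with
  | nil => exact ⟨b, B, hB, ⟨id, strictMono_id, fun _ _ => Iff.rfl⟩, by simp⟩
  | cons A l ih =>
    obtain ⟨c₁, C₁, hC₁, ⟨f, hf⟩, hl₁⟩ := ih fun A' hA' => hl A' (List.mem_cons_of_mem _ hA')
    obtain ⟨c₂, C₂, hC₂, ⟨g, hg⟩, ⟨g', hg'⟩⟩ :=
      exists_joint_ordEmb hn A C₁ (hl A List.mem_cons_self) hC₁
    refine ⟨c₂, C₂, hC₂, ⟨g' ∘ f, hg'.comp hf⟩, fun A' hA' => ?_⟩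
    rcases List.mem_cons.1 hA' with rfl | hA'
    · exact ⟨g, hg⟩
    · obtain ⟨g₁, hg₁⟩ := hl₁ A' hA'
      exact ⟨g' ∘ g₁, hg'.comp hg₁⟩

lemma strictMono_pair {x y : Fin b} (h : x < y) : StrictMono ![x, y] := by
  intro i j hij
  fin_cases i <;> fin_cases j <;> simp_all

lemma ordEmb_pair_top {B : SimpleGraph (Fin b)} {x y : Fin b} (h : x < y) (hadj : B.Adj x y) :
    OrdEmb (⊤ : SimpleGraph (Fin 2)) B ![x, y] := by
  refine ⟨strictMono_pair h, fun i j => ?_⟩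
  fin_cases i <;> fin_cases j <;> simp [hadj, hadj.symm]

lemma ordEmb_pair_bot {B : SimpleGraph (Fin b)} {x y : Fin b} (h : x < y) (hadj : ¬ B.Adj x y) :
    OrdEmb (⊥ : SimpleGraph (Fin 2)) B ![x, y] := by
  refine ⟨strictMono_pair h, fun i j => ?_⟩
  have hadj' : ¬ B.Adj y x := fun h' => hadj h'.symm
  fin_cases i <;> fin_cases j <;> simp [hadj, hadj']

/-- The path `0 - 1 - 2`. -/
def monotonePath : SimpleGraph (Fin 3) where
  Adj i j := i.val + 1 = j.val ∨ j.val + 1 = i.val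
  symm := ⟨fun _ _ h => h.symm⟩
  loopless := ⟨fun _ h => by omega⟩

lemma monotonePath_cliqueFree {n : ℕ} (hn : 3 ≤ n) : monotonePath.CliqueFree n := by
  rw [cliqueFree_iff_forall_family]
  intro c hc
  have h₁ := hc ⟨0, by omega⟩ ⟨1, by omega⟩ (by simp)
  have h₂ := hc ⟨1, by omega⟩ ⟨2, by omega⟩ (by simp)
  have h₃ := hc ⟨0, by omega⟩ ⟨2, by omega⟩ (by simp)
  simp only [monotonePath] at h₁ h₂ h₃
  omega

/-- The ordering property: some `K_n`-free graph contains every order type of `X` under each of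
its linear orders. -/
theorem exists_ordering_property {n : ℕ} (hn : 3 ≤ n) (X : SimpleGraph (Fin a))
    (hX : X.CliqueFree n) :
    ∃ (b : ℕ) (Y : SimpleGraph (Fin b)), Y.CliqueFree n ∧
      ∀ (c : ℕ) (h : Fin b → Fin c), Function.Injective h → ∀ A ∈ orderTypes X,
        ∃ f : Fin a → Fin b, StrictMono (h ∘ f) ∧ ∀ i j, Y.Adj (f i) (f j) ↔ A.Adj i j := by
  classical
  obtain ⟨d, B, hB, ⟨q, hq⟩, hAB⟩ := exists_joint_ordEmb_list (by omega) monotonePath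
    (monotonePath_cliqueFree hn) (orderTypes X).toFinset.toList
    fun A hA => cliqueFree_of_mem_orderTypes (by simpa using hA) hX
  replace hAB : ∀ A ∈ orderTypes X, ∃ g, OrdEmb A B g := fun A hA => hAB A (by simpa using hA)
  have hpair : ∀ A : SimpleGraph (Fin 2), A.CliqueFree n := fun A =>
    A.cliqueFree_of_card_lt (by simpa using by omega)
  obtain ⟨b, Y, hY, hχ⟩ := exists_cliqueFree_ordArrow_list n Bool B hB
    [(⊤ : SimpleGraph (Fin 2)), ⊥] fun A _ => hpair A
  refine ⟨b, Y, hY, fun c h hh => ?_⟩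
  obtain ⟨g, hg, hmono⟩ := hχ fun f => decide (h (f 0) < h (f 1))
  have hedge : ∀ x y x' y', x < y → x' < y' → B.Adj x y → B.Adj x' y' →
      (h (g x) < h (g y) ↔ h (g x') < h (g y')) := by
    intro x y x' y' hxy hxy' hadj hadj'
    simpa using hmono ⊤ (by simp) _ _ (ordEmb_pair_top hxy hadj) (ordEmb_pair_top hxy' hadj')
  have hnonedge : ∀ x y x' y', x < y → x' < y' → ¬ B.Adj x y → ¬ B.Adj x' y' →
      (h (g x) < h (g y) ↔ h (g x') < h (g y')) := by
    intro x y x' y' hxy hxy' hadj hadj'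
    simpa using hmono ⊥ (by simp) _ _ (ordEmb_pair_bot hxy hadj) (ordEmb_pair_bot hxy' hadj')
  have h01 : q 0 < q 1 := hq.1 (by simp)
  have h12 : q 1 < q 2 := hq.1 (by simp)
  have a01 : B.Adj (q 0) (q 1) := (hq.2 _ _).2 (by simp [monotonePath])
  have a12 : B.Adj (q 1) (q 2) := (hq.2 _ _).2 (by simp [monotonePath])
  have a02 : ¬ B.Adj (q 0) (q 2) := fun hadj => by
    have := (hq.2 _ _).1 hadj
    simp [monotonePath] at this
  have hne : ∀ x y, x ≠ y → h (g x) ≠ h (g y) := fun x y hxy heq =>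
    hxy (hg.1.injective (hh heq))
  have hsame : h (g (q 0)) < h (g (q 1)) ↔ h (g (q 0)) < h (g (q 2)) := by
    have h0112 := hedge _ _ _ _ h01 h12 a01 a12
    constructor
    · exact fun hlt => hlt.trans (h0112.1 hlt)
    · intro hlt
      by_contra hnot
      have h₁ := not_lt.1 hnot
      have h₂ := not_lt.1 fun h' => hnot (h0112.2 h')
      exact absurd hlt (not_lt.2 (h₂.trans h₁))
  have hall : ∀ x y, x < y → (h (g x) < h (g y) ↔ h (g (q 0)) < h (g (q 1))) := by
    intro x y hxy
    by_cases hadj : B.Adj x y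
    · exact hedge _ _ _ _ hxy h01 hadj a01
    · exact (hnonedge _ _ _ _ hxy (h01.trans h12) hadj a02).trans hsame.symm
  intro A hA
  by_cases hdir : h (g (q 0)) < h (g (q 1))
  · obtain ⟨f, hf⟩ := hAB A hA
    exact ⟨g ∘ f, fun i j hij => (hall _ _ (hf.1 hij)).2 hdir, (hg.comp hf).2⟩
  · obtain ⟨f, hf⟩ := hAB _ (comap_rev_mem_orderTypes hA)
    refine ⟨g ∘ f ∘ Fin.rev, fun i j hij => ?_, fun i j => ?_⟩
    · have hlt := hf.1 (Fin.rev_lt_rev.2 hij)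
      exact (lt_or_gt_of_ne (hne _ _ hlt.ne)).resolve_left fun h' => hdir ((hall _ _ hlt).1 h')
    · refine ((hg.comp hf).2 _ _).trans ?_
      simp

end OrderingProperty

section RamseyDegree

variable {n a : ℕ}

/-- The number of order types bounds the Ramsey degree from above. -/
theorem exists_few_colors (hn : 0 < n) (X : SimpleGraph (Fin a)) (hX : X.CliqueFree n) {b : ℕ}
    (Y : SimpleGraph (Fin b)) (hY : Y.CliqueFree n) (k : ℕ) :
    ∃ (c : ℕ) (Z : SimpleGraph (Fin c)), Z.CliqueFree n ∧ ∀ α : Finset (Fin c) → Fin k,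
      ∃ T : Finset (Fin c), IsCopy Y Z T ∧ ∃ V : Finset (Fin k),
        V.card ≤ Nat.card (orderTypes X) ∧
          ∀ S : Finset (Fin c), S ⊆ T → IsCopy X Z S → α S ∈ V := by
  classical
  rcases Nat.eq_zero_or_pos k with rfl | hk
  · refine ⟨0, ⊥, ?_, fun α => (α ∅).elim0⟩
    exact SimpleGraph.cliqueFree_of_card_lt (by rwa [Fintype.card_fin])
  have : Nonempty (Fin k) := ⟨⟨0, hk⟩⟩
  obtain ⟨c, Z, hZ, h⟩ := exists_cliqueFree_ordArrow_list n (Fin k) Y hY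
    (orderTypes X).toFinset.toList
    fun A hA => cliqueFree_of_mem_orderTypes (by simpa using hA) hX
  refine ⟨c, Z, hZ, fun α => ?_⟩
  obtain ⟨g, hg, hmono⟩ := h fun f => α (Finset.univ.image f)
  let color (A : SimpleGraph (Fin a)) : Fin k :=
    if h : ∃ f, OrdEmb A Y f then α (Finset.univ.image (g ∘ h.choose)) else ⟨0, hk⟩
  refine ⟨Finset.univ.image g, ⟨g, hg.1.injective, hg.2, rfl⟩, (orderTypes X).toFinset.image color,
    ?_, fun S hS hcopy => ?_⟩
  · rw [Nat.card_eq_fintype_card, ← Set.toFinset_card]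
    exact Finset.card_image_le
  · obtain ⟨R, -, rfl⟩ := Finset.subset_image_iff.1 hS
    have hR : R.card = a := by
      obtain ⟨f, hf, -, himage⟩ := hcopy
      rw [← Finset.card_image_of_injective R hg.1.injective, ← himage,
        Finset.card_image_of_injective _ hf, Finset.card_fin]
    let f := R.orderEmbOfFin hR
    have himage : R.image g = Finset.univ.image (g ∘ f) := by
      rw [← Finset.image_image]
      congr 1
      simp [f]
    have hA : Z.comap (g ∘ f) ∈ orderTypes X :=
      comap_mem_orderTypes (hg.1.comp f.strictMono).injective (himage ▸ hcopy)
    have hf : OrdEmb (Z.comap (g ∘ f)) Y f := ⟨f.strictMono, fun i j => (hg.2 _ _).symm⟩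
    refine Finset.mem_image.2 ⟨Z.comap (g ∘ f), by simpa using hA, ?_⟩
    have hex : ∃ f', OrdEmb (Z.comap (g ∘ f)) Y f' := ⟨f, hf⟩
    rw [himage]
    simp only [color, dif_pos hex]
    exact hmono _ (by simpa using hA) _ _ hex.choose_spec hf

/-- Some colouring by order types shows all order types in each copy of a suitable graph. -/
theorem exists_many_colors (hn : 3 ≤ n) (X : SimpleGraph (Fin a)) (hX : X.CliqueFree n) :
    ∃ (b : ℕ) (Y : SimpleGraph (Fin b)), Y.CliqueFree n ∧ ∀ (c : ℕ) (Z : SimpleGraph (Fin c)),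
      ∃ α : Finset (Fin c) → Fin (Nat.card (orderTypes X)), ∀ T : Finset (Fin c), IsCopy Y Z T →
        ∀ r, ∃ S ⊆ T, IsCopy X Z S ∧ α S = r := by
  classical
  obtain ⟨b, Y, hY, hord⟩ := exists_ordering_property hn X hX
  refine ⟨b, Y, hY, fun c Z => ?_⟩
  let e := Finite.equivFin (orderTypes X)
  refine ⟨fun S => if h : ∃ hS : S.card = a, Z.comap (S.orderEmbOfFin hS) ∈ orderTypes X
    then e ⟨_, h.choose_spec⟩ else e ⟨X, self_mem_orderTypes X⟩, ?_⟩
  rintro T ⟨g, hg, hadj, rfl⟩ r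
  obtain ⟨⟨A, hA⟩, rfl⟩ := e.surjective r
  obtain ⟨f, hf, hfA⟩ := hord c g hg A hA
  have hcard : (Finset.univ.image (g ∘ f)).card = a := by
    rw [Finset.card_image_of_injective _ hf.injective, Finset.card_fin]
  have hZA : Z.comap (g ∘ f) = A := by
    ext i j
    exact (hadj _ _).trans (hfA i j)
  have henum : ⇑((Finset.univ.image (g ∘ f)).orderEmbOfFin hcard) = g ∘ f :=
    (Finset.orderEmbOfFin_unique hcard
      (fun x => Finset.mem_image_of_mem _ (Finset.mem_univ x)) hf).symm
  refine ⟨Finset.univ.image (g ∘ f), ?_, ?_, ?_⟩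
  · rw [← Finset.image_image]
    exact Finset.image_subset_image (Finset.subset_univ _)
  · obtain ⟨θ⟩ := hA
    refine ⟨g ∘ f ∘ θ.symm, hf.injective.comp θ.symm.injective, fun i j => ?_, ?_⟩
    · exact ((hadj _ _).trans (hfA _ _)).trans θ.symm.map_rel_iff
    · ext z
      simp only [Finset.mem_image, Finset.mem_univ, true_and, Function.comp_apply]
      exact (θ.symm.surjective.exists (p := fun i => g (f i) = z)).symm
  · have hex : ∃ hS : (Finset.univ.image (g ∘ f)).card = a,
        Z.comap ((Finset.univ.image (g ∘ f)).orderEmbOfFin hS) ∈ orderTypes X :=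
      ⟨hcard, by rw [henum, hZA]; exact hA⟩
    dsimp only
    rw [dif_pos hex]
    congr 1
    exact Subtype.ext ((congrArg (SimpleGraph.comap · Z) henum).trans hZA)

end RamseyDegree

/-- every finite `K_n`-free graph `X` has Ramsey degree
`|X|! / |Aut(X)|` in the class of finite `K_n`-free graphs. -/
theorem stmt_1 (n : ℕ) (hn : 3 ≤ n) (a : ℕ)
    (X : SimpleGraph (Fin a)) (hX : X.CliqueFree n) :
    IsLeast {t : ℕ |
      ∀ (b : ℕ) (Y : SimpleGraph (Fin b)), Y.CliqueFree n →
        ∀ k : ℕ, ∃ (c : ℕ) (Z : SimpleGraph (Fin c)), Z.CliqueFree n ∧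
          ∀ α : Finset (Fin c) → Fin k,
            ∃ T : Finset (Fin c), IsCopy Y Z T ∧
              ∃ V : Finset (Fin k), V.card ≤ t ∧
                ∀ S : Finset (Fin c), S ⊆ T → IsCopy X Z S → α S ∈ V}
      (a.factorial / Nat.card (X ≃g X)) := by
  rw [factorial_div_card_aut]
  refine ⟨fun b Y hY k => exists_few_colors (by omega) X hX Y hY k, fun t ht => ?_⟩
  obtain ⟨b, Y, hY, hmany⟩ := exists_many_colors hn X hX
  obtain ⟨c, Z, -, hZ⟩ := ht b Y hY (Nat.card (orderTypes X))
  obtain ⟨α, hα⟩ := hmany c Z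
  obtain ⟨T, hT, V, hVt, hV⟩ := hZ α
  have huniv : V = Finset.univ := Finset.eq_univ_of_forall fun r => by
    obtain ⟨S, hST, hS, rfl⟩ := hα T hT r
    exact hV S hST hS
  rwa [huniv, Finset.card_fin] at hVt
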